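/- arXiv:2512.22224 — 4 statements merged into one kernel-verified Lean document; each statement's English description precedes it below -/
import Mathlib

section
/- The value of the improper integral ∫₀^∞ exp(−x²·erf(x)) dx lies strictly between 0.972106 and 0.972107. -/
open Real MeasureTheory

/-- The error function `erf x = (2/√π) ∫₀ˣ exp(−t²) dt`. -/
noncomputable def erf (x : ℝ) : ℝ := (2 / Real.sqrt π) * ∫ t in (0:ℝ)..x, Real.exp (-t ^ 2)

open Set

/-! ### Polynomials as lists of rational coefficients -/

namespace ListPoly

/-- The value at `t` of the polynomial with coefficients `p` (constant term first). -/
def eval {K : Type*} [DivisionRing K] : List ℚ → K → K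
  | [], _ => 0
  | a :: p, t => (a : K) + t * eval p t

/-- Sum of two polynomials. -/
def add : List ℚ → List ℚ → List ℚ
  | [], q => q
  | a :: p, [] => a :: p
  | a :: p, b :: q => (a + b) :: add p q

/-- Product of a polynomial by a constant. -/
def smul (c : ℚ) (p : List ℚ) : List ℚ := p.map (c * ·)

/-- Product of two polynomials. -/
def mul : List ℚ → List ℚ → List ℚ
  | [], _ => []
  | a :: p, q => add (smul a q) (0 :: mul p q)

/-- Derivative of a polynomial. -/
def derivative : List ℚ → List ℚ
  | [] => []
  | _ :: p => add p (0 :: derivative p)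

/-- An upper bound for the absolute value of a polynomial on `[-h, h]`. -/
def absBound (h : ℚ) : List ℚ → ℚ
  | [] => 0
  | a :: p => |a| + h * absBound h p

theorem eval_cast (p : List ℚ) (t : ℚ) : eval p (t : ℝ) = ((eval p t : ℚ) : ℝ) := by
  induction p with
  | nil => simp [eval]
  | cons a p ih => simp [eval, ih]

theorem eval_add (p q : List ℚ) (t : ℝ) : eval (add p q) t = eval p t + eval q t := by
  induction p generalizing q with
  | nil => simp [add, eval]
  | cons a p ih =>
    cases q with
    | nil => simp [add, eval]
    | cons b q => simp only [add, eval, ih]; push_cast; ring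

theorem eval_smul (c : ℚ) (p : List ℚ) (t : ℝ) : eval (smul c p) t = c * eval p t := by
  induction p with
  | nil => simp [smul, eval]
  | cons a p ih =>
    simp only [smul, List.map_cons, eval] at ih ⊢
    rw [ih]; push_cast; ring

theorem eval_mul (p q : List ℚ) (t : ℝ) : eval (mul p q) t = eval p t * eval q t := by
  induction p with
  | nil => simp [mul, eval]
  | cons a p ih => simp only [mul, eval, eval_add, eval_smul, ih]; push_cast; ring

theorem hasDerivAt_eval (p : List ℚ) (t : ℝ) :
    HasDerivAt (fun t : ℝ => eval p t) (eval (derivative p) t) t := by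
  induction p with
  | nil => simpa [eval, derivative] using hasDerivAt_const t (0 : ℝ)
  | cons a p ih =>
    simp only [eval, derivative, eval_add]
    refine (((hasDerivAt_id t).mul ih).const_add (a : ℝ)).congr_deriv ?_
    simp

theorem abs_eval_le {h : ℚ} {p : List ℚ} {t : ℝ} (ht : |t| ≤ h) : |eval p t| ≤ absBound h p := by
  induction p with
  | nil => simp [eval, absBound]
  | cons a p ih =>
    simp only [eval, absBound]
    push_cast
    refine (abs_add_le _ _).trans (add_le_add le_rfl ?_)
    rw [abs_mul]
    exact mul_le_mul ht ih (abs_nonneg _) ((abs_nonneg t).trans ht)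

end ListPoly

/-! ### The functions involved -/

/-- If `r' + U' r` is bounded by `ε` with `U' ≥ 0`, then `|r|` grows at most at rate `ε`. -/
theorem abs_le_add_mul_of_damped {r r' U U' : ℝ → ℝ} {a b ε η : ℝ}
    (hr : ∀ x, HasDerivAt r (r' x) x) (hU : ∀ x, HasDerivAt U (U' x) x)
    (hU' : ∀ x ∈ Icc a b, 0 ≤ U' x) (hε : ∀ x ∈ Icc a b, |r' x + U' x * r x| ≤ ε)
    (ha : |r a| ≤ η) {x : ℝ} (hx : x ∈ Icc a b) : |r x| ≤ η + ε * (x - a) := by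
  have key : ∀ s : ℝ, |s| = 1 → s * r x ≤ η + ε * (x - a) := by
    intro s hs
    have hd : ∀ y, HasDerivAt (fun y => exp (U y) * (η + ε * (y - a) - s * r y))
        (exp (U y) * U' y * (η + ε * (y - a) - s * r y) + exp (U y) * (ε - s * r' y)) y := by
      intro y
      refine (hU y).exp.mul ?_
      refine (((((hasDerivAt_id y).sub_const a).const_mul ε).const_add η).sub
        ((hr y).const_mul s)).congr_deriv ?_
      simp
    have hsr : ∀ y, s * y ≤ |y| := fun y => by
      simpa [abs_mul, hs] using le_abs_self (s * y)
    have hη : 0 ≤ η := (abs_nonneg _).trans ha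
    have hmono : MonotoneOn (fun y => exp (U y) * (η + ε * (y - a) - s * r y)) (Icc a b) := by
      refine monotoneOn_of_deriv_nonneg (convex_Icc a b)
        (fun y _ => (hd y).continuousAt.continuousWithinAt)
        (fun y _ => (hd y).differentiableAt.differentiableWithinAt) (fun y hy => ?_)
      have hy' := interior_subset hy
      rw [(hd y).deriv]
      have h1 := (hsr _).trans (hε y hy')
      have h2 : 0 ≤ ε := (abs_nonneg _).trans (hε y hy')
      have h3 : 0 ≤ U' y * (η + ε * (y - a)) :=
        mul_nonneg (hU' y hy') (add_nonneg hη (mul_nonneg h2 (sub_nonneg.2 hy'.1)))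
      have h4 : 0 ≤ exp (U y) * (U' y * (η + ε * (y - a)) + (ε - s * (r' y + U' y * r y))) :=
        mul_nonneg (exp_pos _).le (add_nonneg h3 (sub_nonneg.2 h1))
      linarith
    have h := hmono ⟨le_rfl, hx.1.trans hx.2⟩ hx hx.1
    have h0 : 0 ≤ exp (U a) * (η + ε * (a - a) - s * r a) := by
      refine mul_nonneg (exp_pos _).le ?_
      have := (hsr (r a)).trans ha
      rw [sub_self, mul_zero, add_zero]
      exact sub_nonneg.2 this
    have := nonneg_of_mul_nonneg_right (h0.trans h) (exp_pos _)
    linarith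
  rcases abs_cases (r x) with ⟨h, -⟩ | ⟨h, -⟩ <;> rw [h]
  · simpa using key 1 (by simp)
  · simpa using key (-1) (by simp)

/-- The Gaussian integral over `[0, x]`. -/
noncomputable def gaussPrimitive (x : ℝ) : ℝ := ∫ t in (0:ℝ)..x, exp (-t ^ 2)

theorem erf_eq (x : ℝ) : erf x = 2 / √π * gaussPrimitive x := rfl

theorem hasDerivAt_gaussPrimitive (x : ℝ) :
    HasDerivAt gaussPrimitive (exp (-x ^ 2)) x := by
  have hc : Continuous fun t : ℝ => exp (-t ^ 2) := by fun_prop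
  exact intervalIntegral.integral_hasDerivAt_right (hc.intervalIntegrable _ _)
    (hc.stronglyMeasurableAtFilter _ _) hc.continuousAt

theorem monotone_gaussPrimitive : Monotone gaussPrimitive :=
  monotone_of_deriv_nonneg (fun x => (hasDerivAt_gaussPrimitive x).differentiableAt)
    fun x => by rw [(hasDerivAt_gaussPrimitive x).deriv]; positivity

theorem gaussPrimitive_nonneg {x : ℝ} (hx : 0 ≤ x) : 0 ≤ gaussPrimitive x := by
  simpa [gaussPrimitive] using monotone_gaussPrimitive hx

/-- The integrand `exp (-x² erf x)`. -/
noncomputable def integrand (x : ℝ) : ℝ := exp (-x ^ 2 * erf x)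

theorem hasDerivAt_sq_mul_erf (x : ℝ) :
    HasDerivAt (fun x => x ^ 2 * erf x)
      (2 / √π * (x * (2 * gaussPrimitive x + x * exp (-x ^ 2)))) x := by
  have h := (hasDerivAt_pow 2 x).mul ((hasDerivAt_gaussPrimitive x).const_mul (2 / √π))
  refine h.congr_deriv ?_
  push_cast
  ring

theorem hasDerivAt_integrand (x : ℝ) :
    HasDerivAt integrand
      (-(2 / √π * (x * (2 * gaussPrimitive x + x * exp (-x ^ 2)))) * integrand x) x := by
  have h := (hasDerivAt_sq_mul_erf x).neg.exp
  simp only [Pi.neg_apply, ← neg_mul] at h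
  refine h.congr_deriv ?_
  rw [integrand]
  ring

theorem continuous_integrand : Continuous integrand :=
  continuous_iff_continuousAt.2 fun x => (hasDerivAt_integrand x).continuousAt

theorem hasDerivAt_integral_integrand (x : ℝ) :
    HasDerivAt (fun x => ∫ t in (0:ℝ)..x, integrand t) (integrand x) x :=
  intervalIntegral.integral_hasDerivAt_right (continuous_integrand.intervalIntegrable _ _)
    (continuous_integrand.stronglyMeasurableAtFilter _ _) continuous_integrand.continuousAt

/-- A rational approximation of `2 / √π`. -/
def kappa : ℚ := 11283791670955126 / 10000000000000000

theorem abs_two_div_sqrt_pi_sub_kappa_le : |2 / √π - kappa| ≤ 1 / 10 ^ 15 := by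
  have h1 := Real.pi_gt_d20
  have h2 := Real.pi_lt_d20
  have hs : 0 < √π := Real.sqrt_pos.2 Real.pi_pos
  have hsq : √π * √π = π := Real.mul_self_sqrt Real.pi_pos.le
  have hlow : (1.7724538509055157 : ℝ) ≤ √π := Real.le_sqrt_of_sq_le (by norm_num; linarith)
  have hupp : √π ≤ 1.7724538509055162 := Real.sqrt_le_iff.2 ⟨by norm_num, by norm_num; linarith⟩
  rw [abs_le, kappa]
  constructor
  · rw [neg_le_sub_iff_le_add, ← sub_le_iff_le_add, le_div_iff₀ hs]
    push_cast
    nlinarith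
  · rw [sub_le_iff_le_add, div_le_iff₀ hs]
    push_cast
    nlinarith

/-! ### Piecewise polynomial approximations

On `[n / 2, (n + 1) / 2]`, `n < 8`, all polynomials are in the variable `x - (2 n + 1) / 4`. -/

/-- Coefficients, multiplied by `10 ^ 16`, of approximations of `gaussPrimitive`. -/
def gaussTable : List (List ℤ) :=
  [[2448878871802558, 9394130628134758, -2348532657033689, -2739954766539304, 1125338564828643,
   709452573478927, -359211331744215, -143259327132301, 85927564748101, 23082226678608,
   -16430122844704, -3030267872649, 2615673713588, 326742634082, -356593385976, -28567403735,
   42495293064, 1900955028],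
  [6302452707311626, 5697828247309230, -4273371185481923, 237409510304551, 1335428495463101,
   -471851401730296, -238151415024253, 163378017917172, 20399067717156, -35167792547865,
   1648667954685, 5529911332194, -941037091477, -671278087575, 196015455512, 63509074815,
   -28822445574, -4461520407],
  [8178989431646770, 2096113871510978, -2620142339388723, 1484747325653610, -54586298737265,
   -418131048327450, 188777616466375, 32134434197116, -50494357072251, 7777848092853,
   7032312567409, -2870991635060, -467378646849, 494763944723, -26718355380, -56803429164,
   11992677268, 4501455089],
  [8744150016159106, 467706223839590, -818485891719282, 798998132392633, -426294735270459,
   58706874971532, 79432919005396, -53694286876872, 6469910721761, 7924479389818, -3923774136972,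
   -48259402025, 608586891798, -157044503917, -40992090522, 29008426369, -1563182707,
   -2877627057],
  [8849306266293348, 63297154274857, -142418597118429, 192528844252691, -169122084078135,
   94451222394514, -25739194375049, -5941761329019, 8857782399370, -3273548719042, -101619947430,
   577243405246, -201069315236, -11805204440, 30309164975, -7631152752, -1389807536, 1209561489],
  [8861377515960848, 5195746821548, -14288303759258, 24463307951457, -28874280513501,
   24422716179414, -14687681694196, 5725388907484, -788844510853, -631198419823, 487398155054,
   -140412063374, -9492676265, 23817833511, -8105224537, 23041038, 937689172, -305911317],
  [8862231122137430, 258681002227, -840713257236, 1735318389936, -2539654631235, 2780955503624,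
   -2335460560597, 1506509686358, -723583285752, 229655489585, -20639039652, -25384193047,
   16876898454, -4858627130, 30266097, 588429003, -242580327, 27851044],
  [8862268246646011, 7811489408, -29293085281, 70628883400, -122664794615, 162808526902,
   -170800046730, 144236115092, -98621347885, 54138545303, -23071224909, 6871345934, -798951071,
   -508102655, 377554036, -125869070, 14953156, 7285638]]

/-- Coefficients, multiplied by `10 ^ 16`, of approximations of the primitive of `integrand`. -/
def integralTable : List (List ℤ) :=
  [[2489185127479525, 9828778791251544, -1004570378075883, -2519044504444124, -1838405524710767,
   1754909982540729, 1297705496135938, -475639194683067, -1049800586395960, 47500395657142,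
   624565304623635, 136456232543328, -333407400261410, -154889325418326, 153205391385165,
   119600029321900, -58942415593600, -76806936871189, 16230120988716, 43706037297322,
   -212448982869, -22591162917809],
  [6790632565562735, 6703032587974703, -4787246139930110, -858385596259545, 2656883761739264,
   -12217977926912, -1713921547072166, 516457602836477, 872616181452362, -540212341710031,
   -362885413941382, 409223431349028, 93519090854680, -251841304452419, 16259797150909,
   130992165494165, -43272637351865, -57019216322290, 37253535919184, 19299646363940,
   -23750328478160, -3447707646748],
  [8983162481074854, 2364469402365712, -3164623078564588, 1994367295019056, -82288438638022,
   -867863441021125, 619301877982405, 762723473, -299910211935981, 202527336551009,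
   8846271877078, -100922489898568, 60028549661681, 8329103371056, -32022382937317,
   15934746156954, 4296239936456, -9459801597186, 3805896131209, 1746831229828, -2612847595042,
   794666638575],
  [9600147772806195, 487192040421256, -880593346384069, 916810378879320, -568432728814526,
   160681111425996, 58848991689034, -95664722547473, 57620516100573, -15940097081557,
   -7123860544251, 11847618508118, -6863600837131, 1120138579850, 1430387302365, -1396310311647,
   580337616151, 4412059455, -189076216708, 141227792811, -43130142796, -14163535170],
  [9708054417163137, 63767609586119, -144420109499671, 197875272655418, -179086659645945,
   108014678687508, -39333255251838, 3693816846520, 4875533944996, -3612668722481, 1834690400331,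
   -931857553992, 334994906974, 46453845206, -147867306587, 88242176627, -20585296559,
   -4398522918, 4951543083, -2074711230, 1033135540, -592419271],
  [9720177828509612, 5199702046846, -14309268833636, 24534652010855, -29048818430651,
   24748174679070, -15165592673594, 6287197843888, -1318887213781, -236089649352, 266812055607,
   -64401943963, -5538000019, -2700669141, 11431175898, -7233921753, 1161828132, 1125221741,
   -849125441, 196062742, 62655461, -55690541],
  [9721031794395732, 258692759056, -840787728027, 1735624807793, -2540574003557, 2783095568298,
   -2339473693412, 1512721116231, -731642963817, 238502308536, -28878957673, -18897664300,
   12624008368, -2620072411, -823304297, 727450983, -141771925, -81089493, 70723342, -22520098,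
   -613898, 4173401],
  [9721068919809383, 7811501901, -29293177210, 70629325875, -122666360016, 162812863310,
   -170809829957, 144254572095, -98651012001, 54179704250, -23120992844, 6924119861, -848197430,
   -467642565, 348379598, -107563527, 5138758, 11606634, -6003225, 1283211, 165188, -243819]]

/-- Approximation of `gaussPrimitive` on the `n`-th interval. -/
def gaussPoly (n : ℕ) : List ℚ :=
  (gaussTable.getD n []).map fun z => (z : ℚ) / 10000000000000000

/-- Approximation of the primitive of `integrand` on the `n`-th interval. -/
def integralPoly (n : ℕ) : List ℚ :=
  (integralTable.getD n []).map fun z => (z : ℚ) / 10000000000000000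

/-- Approximation of `exp (-x ^ 2)` on the `n`-th interval. -/
def expPoly (n : ℕ) : List ℚ := ListPoly.derivative (gaussPoly n)

/-- Approximation of `integrand` on the `n`-th interval. -/
def integrandPoly (n : ℕ) : List ℚ := ListPoly.derivative (integralPoly n)

/-- The identity function on the `n`-th interval. -/
def idPoly (n : ℕ) : List ℚ := [(2 * n + 1) / 4, 1]

/-- Approximation of `x * (2 * gaussPrimitive x + x * exp (-x ^ 2))` on the `n`-th interval. -/
def dampingPoly (n : ℕ) : List ℚ :=
  ListPoly.mul (idPoly n)
    (ListPoly.add (ListPoly.smul 2 (gaussPoly n)) (ListPoly.mul (idPoly n) (expPoly n)))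

/-- The value `v` at `0`, and the value of the approximation `p` at the right end of the
interval preceding `n / 2` for `n > 0`. -/
def nodeValue (v : ℚ) (p : ℕ → List ℚ) : ℕ → ℚ
  | 0 => v
  | n + 1 => ListPoly.eval (p n) (1 / 4 : ℚ)

/-- The jump at `n / 2` of the piecewise polynomial `p` with value `v` at `0`. -/
def jump (v : ℚ) (p : ℕ → List ℚ) (n : ℕ) : ℚ :=
  |nodeValue v p n - ListPoly.eval (p n) (-1 / 4 : ℚ)|

theorem jump_expPoly_le : ∀ n < 8, jump 1 expPoly n ≤ 1 / 1000000000000000 := by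
  decide +kernel

theorem jump_gaussPoly_le : ∀ n < 8, jump 0 gaussPoly n ≤ 1 / 1000000000000000 := by
  decide +kernel

theorem jump_integrandPoly_le : ∀ n < 8, jump 1 integrandPoly n ≤ 1 / 100000000000000 := by
  decide +kernel

theorem jump_integralPoly_le : ∀ n < 8, jump 0 integralPoly n ≤ 1 / 1000000000000000 := by
  decide +kernel

theorem absBound_expPoly_defect_le : ∀ n < 8, ListPoly.absBound (1 / 4)
    (ListPoly.add (ListPoly.derivative (expPoly n))
      (ListPoly.mul (ListPoly.smul 2 (idPoly n)) (expPoly n))) ≤ 35 / 1000000000000000 := by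
  decide +kernel

theorem absBound_integrandPoly_defect_le : ∀ n < 8, ListPoly.absBound (1 / 4)
    (ListPoly.add (ListPoly.derivative (integrandPoly n))
      (ListPoly.mul (ListPoly.smul kappa (dampingPoly n)) (integrandPoly n))) ≤
      1 / 1000000000000 := by
  decide +kernel

theorem absBound_integrandPoly_le : ∀ n < 8,
    ListPoly.absBound (1 / 4) (integrandPoly n) ≤ 6 / 5 := by
  decide +kernel

theorem absBound_dampingPoly_le : ∀ n < 8, ListPoly.absBound (1 / 4) (dampingPoly n) ≤ 8 := by
  decide +kernel

theorem hasDerivAt_eval_sub (p : List ℚ) (c x : ℝ) :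
    HasDerivAt (fun x => ListPoly.eval p (x - c))
      (ListPoly.eval (ListPoly.derivative p) (x - c)) x :=
  (ListPoly.hasDerivAt_eval p (x - c)).comp_sub_const x c

theorem eval_idPoly (n : ℕ) (x : ℝ) :
    ListPoly.eval (idPoly n) (x - (2 * n + 1) / 4) = x := by
  simp [idPoly, ListPoly.eval]

theorem abs_sub_eval_left_le {n : ℕ} {v : ℚ} {p : ℕ → List ℚ} {j : ℚ} {y η : ℝ}
    (hj : jump v p n ≤ j) (hy : |y - nodeValue v p n| ≤ η) :
    |y - ListPoly.eval (p n) ((n : ℝ) / 2 - (2 * n + 1) / 4)| ≤ η + j := by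
  have h1 : (n : ℝ) / 2 - (2 * n + 1) / 4 = ((-1 / 4 : ℚ) : ℝ) := by push_cast; ring
  have h2 : |(nodeValue v p n : ℝ) - ((ListPoly.eval (p n) (-1 / 4 : ℚ) : ℚ) : ℝ)| ≤ j := by
    rw [← Rat.cast_sub, ← Rat.cast_abs]
    exact Rat.cast_le.2 hj
  rw [h1, ListPoly.eval_cast]
  exact (abs_sub_le _ _ _).trans (add_le_add hy h2)

theorem eval_right (n : ℕ) (v : ℚ) (p : ℕ → List ℚ) :
    ListPoly.eval (p n) (((n + 1 : ℕ) : ℝ) / 2 - (2 * n + 1) / 4) = nodeValue v p (n + 1) := by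
  rw [nodeValue, ← ListPoly.eval_cast]
  congr 1
  push_cast
  ring

/-- The approximations at the left of `n / 2` are close to the functions they approximate. -/
structure ApproxAt (n : ℕ) : Prop where
  gauss_close : |exp (-((n : ℝ) / 2) ^ 2) - nodeValue 1 expPoly n| ≤ n * (2 / 10 ^ 14)
  primitive_close : |gaussPrimitive (n / 2) - nodeValue 0 gaussPoly n| ≤ n * (15 / 10 ^ 14)
  integrand_close : |integrand (n / 2) - nodeValue 1 integrandPoly n| ≤ n * (1 / 10 ^ 11)
  integral_close : |(∫ t in (0:ℝ)..(n / 2), integrand t) - nodeValue 0 integralPoly n| ≤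
    n * (5 / 10 ^ 11)

theorem ApproxAt.succ {n : ℕ} (hn : n < 8) (h : ApproxAt n) : ApproxAt (n + 1) := by
  have hn0 : (0 : ℝ) ≤ n := n.cast_nonneg
  have hn7 : (n : ℝ) ≤ 7 := by exact_mod_cast Nat.lt_succ_iff.1 hn
  set c : ℝ := (2 * n + 1) / 4 with hc
  set a : ℝ := n / 2 with ha
  set b : ℝ := ((n + 1 : ℕ) : ℝ) / 2 with hb
  have hab : b = a + 1 / 2 := by rw [hb, ha]; push_cast; ring
  have hbI : b ∈ Icc a b := ⟨by linarith, le_rfl⟩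
  have hx0 : ∀ x ∈ Icc a b, 0 ≤ x := fun x hx => (by positivity : 0 ≤ a).trans hx.1
  have hx4 : ∀ x ∈ Icc a b, x ≤ 4 := fun x hx => hx.2.trans (by linarith)
  have hxa : ∀ x ∈ Icc a b, x - a ≤ 1 / 2 := fun x hx => by linarith [hx.2]
  have hid : ∀ x, ListPoly.eval (idPoly n) (x - c) = x := eval_idPoly n
  have hbound : ∀ {p : List ℚ} {B : ℚ}, ListPoly.absBound (1 / 4) p ≤ B →
      ∀ x ∈ Icc a b, |ListPoly.eval p (x - c)| ≤ B := by
    intro p B hB x hx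
    refine (ListPoly.abs_eval_le (h := 1 / 4) ?_).trans (by exact_mod_cast hB)
    rw [abs_le]
    push_cast
    constructor <;> linarith [hx.1, hx.2]
  have hgauss : ∀ x ∈ Icc a b,
      |exp (-x ^ 2) - ListPoly.eval (expPoly n) (x - c)| ≤ (n + 1) * (2 / 10 ^ 14) := by
    intro x hx
    have hd : ∀ x, HasDerivAt (fun x => exp (-x ^ 2) - ListPoly.eval (expPoly n) (x - c))
        (-(2 * x) * exp (-x ^ 2) - ListPoly.eval (ListPoly.derivative (expPoly n)) (x - c)) x := by
      intro x
      refine HasDerivAt.sub ?_ (hasDerivAt_eval_sub _ _ _)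
      refine (hasDerivAt_pow 2 x).neg.exp.congr_deriv ?_
      simp
      ring
    have hU : ∀ x : ℝ, HasDerivAt (fun x => x ^ 2) (2 * x) x := fun x => by
      simpa using hasDerivAt_pow 2 x
    refine (abs_le_add_mul_of_damped (ε := 35 / 10 ^ 15) hd hU
      (fun y hy => by linarith [hx0 y hy]) (fun y hy => ?_)
      (abs_sub_eval_left_le (jump_expPoly_le n hn) h.gauss_close) hx).trans ?_
    · have := hbound (absBound_expPoly_defect_le n hn) y hy
      rw [ListPoly.eval_add, ListPoly.eval_mul, ListPoly.eval_smul, hid, ← abs_neg] at this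
      convert this using 1
      · congr 1; push_cast; ring
      · norm_num
    · have := hxa x hx
      push_cast
      linarith
  have hprim : ∀ x ∈ Icc a b,
      |gaussPrimitive x - ListPoly.eval (gaussPoly n) (x - c)| ≤ (n + 1) * (15 / 10 ^ 14) := by
    intro x hx
    refine (abs_le_add_mul_of_damped (ε := 8 * (2 / 10 ^ 14))
      (fun x => (hasDerivAt_gaussPrimitive x).sub (hasDerivAt_eval_sub _ _ _))
      (fun x => hasDerivAt_const x (0 : ℝ)) (fun _ _ => le_rfl) (fun y hy => ?_)
      (abs_sub_eval_left_le (jump_gaussPoly_le n hn) h.primitive_close) hx).trans ?_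
    · rw [zero_mul, add_zero]
      exact (hgauss y hy).trans (by gcongr; linarith)
    · have := hxa x hx
      push_cast
      linarith
  have hdamping : ∀ x ∈ Icc a b,
      |2 / √π * (x * (2 * gaussPrimitive x + x * exp (-x ^ 2))) -
        kappa * ListPoly.eval (dampingPoly n) (x - c)| ≤ 14 / 10 ^ 12 := by
    intro x hx
    have h0 := hx0 x hx
    have h4 := hx4 x hx
    have hV := hbound (absBound_dampingPoly_le n hn) x hx
    have hk := abs_two_div_sqrt_pi_sub_kappa_le
    have hk2 : |2 / √π| ≤ 113 / 100 := by
      rw [abs_le] at hk ⊢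
      rw [kappa] at hk
      push_cast at hk
      constructor <;> linarith [hk.1, hk.2]
    have hv : |x * (2 * gaussPrimitive x + x * exp (-x ^ 2)) -
        ListPoly.eval (dampingPoly n) (x - c)| ≤ 4 * (2 * (8 * (15 / 10 ^ 14)) +
          4 * (8 * (2 / 10 ^ 14))) := by
      rw [dampingPoly, ListPoly.eval_mul, ListPoly.eval_add, ListPoly.eval_smul, ListPoly.eval_mul,
        hid, ← mul_sub, abs_mul, abs_of_nonneg h0]
      refine mul_le_mul h4 ?_ (abs_nonneg _) (by norm_num)
      rw [add_sub_add_comm, Rat.cast_ofNat, ← mul_sub, ← mul_sub]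
      refine (abs_add_le _ _).trans ?_
      rw [abs_mul, abs_mul, abs_two, abs_of_nonneg h0]
      have h1 := (hprim x hx).trans (mul_le_mul_of_nonneg_right (by linarith : (n + 1 : ℝ) ≤ 8)
        (by norm_num))
      have h2 := (hgauss x hx).trans (mul_le_mul_of_nonneg_right (by linarith : (n + 1 : ℝ) ≤ 8)
        (by norm_num))
      gcongr
    have hsplit : 2 / √π * (x * (2 * gaussPrimitive x + x * exp (-x ^ 2))) -
        kappa * ListPoly.eval (dampingPoly n) (x - c) =
        2 / √π * (x * (2 * gaussPrimitive x + x * exp (-x ^ 2)) -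
          ListPoly.eval (dampingPoly n) (x - c)) +
        (2 / √π - kappa) * ListPoly.eval (dampingPoly n) (x - c) := by ring
    rw [hsplit]
    refine (abs_add_le _ _).trans ?_
    rw [abs_mul, abs_mul]
    refine (add_le_add (mul_le_mul hk2 hv (abs_nonneg _) (by norm_num))
      (mul_le_mul hk hV (abs_nonneg _) (by norm_num))).trans ?_
    norm_num
  have hintegrand : ∀ x ∈ Icc a b,
      |integrand x - ListPoly.eval (integrandPoly n) (x - c)| ≤
        (n + 1) * (1 / 10 ^ 11) := by
    intro x hx
    refine (abs_le_add_mul_of_damped (ε := 18 / 10 ^ 12)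
      (fun x => (hasDerivAt_integrand x).sub (hasDerivAt_eval_sub _ c x))
      hasDerivAt_sq_mul_erf (fun y hy => ?_) (fun y hy => ?_)
      (abs_sub_eval_left_le (jump_integrandPoly_le n hn) h.integrand_close) hx).trans ?_
    · have h0 := hx0 y hy
      have := gaussPrimitive_nonneg h0
      positivity
    · have h1 := hbound (absBound_integrandPoly_defect_le n hn) y hy
      have h2 := hbound (absBound_integrandPoly_le n hn) y hy
      have h3 := mul_le_mul (hdamping y hy) h2 (abs_nonneg _) (by norm_num)
      rw [← abs_mul] at h3
      rw [ListPoly.eval_add, ListPoly.eval_mul, ListPoly.eval_smul] at h1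
      rw [← abs_neg]
      have h4 := (abs_add_le _ _).trans (add_le_add h1 h3)
      push_cast at h4
      refine Eq.trans_le ?_ (h4.trans (by norm_num))
      congr 1
      rw [Pi.sub_apply]
      ring
    · have := hxa x hx
      push_cast
      linarith
  refine ⟨?_, ?_, ?_, ?_⟩
  · rw [← eval_right]
    exact (hgauss b hbI).trans_eq (by push_cast; ring)
  · rw [← eval_right]
    exact (hprim b hbI).trans_eq (by push_cast; ring)
  · rw [← eval_right]
    exact (hintegrand b hbI).trans_eq (by push_cast; ring)
  · rw [← eval_right]
    refine (abs_le_add_mul_of_damped (ε := 8 * (1 / 10 ^ 11))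
      (fun x => (hasDerivAt_integral_integrand x).sub (hasDerivAt_eval_sub _ c x))
      (fun x => hasDerivAt_const x (0 : ℝ)) (fun _ _ => le_rfl) (fun y hy => ?_)
      (abs_sub_eval_left_le (jump_integralPoly_le n hn) h.integral_close) hbI).trans ?_
    · rw [zero_mul, add_zero]
      exact (hintegrand y hy).trans (by gcongr; linarith)
    · rw [hab]
      push_cast
      linarith

theorem approxAt_of_le {n : ℕ} (hn : n ≤ 8) : ApproxAt n := by
  induction n with
  | zero => constructor <;> simp [nodeValue, gaussPrimitive, integrand]
  | succ n ih => exact (ih (Nat.le_of_succ_le hn)).succ hn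

theorem nodeValue_gaussPoly_ge : 8862 / 10000 ≤ nodeValue 0 gaussPoly 8 := by
  decide +kernel

theorem nodeValue_integrandPoly_le : nodeValue 1 integrandPoly 8 ≤ 1126 / 10000000000 := by
  decide +kernel

theorem nodeValue_integralPoly_mem :
    972106978 / 1000000000 ≤ nodeValue 0 integralPoly 8 ∧
      nodeValue 0 integralPoly 8 ≤ 9721069792 / 10000000000 := by
  decide +kernel

theorem erf_four_ge : 999 / 1000 ≤ erf 4 := by
  have h := (approxAt_of_le (le_refl 8)).primitive_close
  have hq := (Rat.cast_le (K := ℝ)).2 nodeValue_gaussPoly_ge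
  have hk := (abs_le.1 abs_two_div_sqrt_pi_sub_kappa_le).1
  rw [kappa] at hk
  push_cast at hk
  norm_num at h hq
  have hg : (8861 / 10000 : ℝ) ≤ gaussPrimitive 4 := by linarith [(abs_le.1 h).1]
  have hk' : (11283 / 10000 : ℝ) ≤ 2 / √π := by linarith
  rw [erf_eq]
  nlinarith

theorem integrand_four_le : integrand 4 ≤ 1127 / 10 ^ 10 := by
  have h := (approxAt_of_le (le_refl 8)).integrand_close
  have hq := (Rat.cast_le (K := ℝ)).2 nodeValue_integrandPoly_le
  norm_num at h hq
  linarith [(abs_le.1 h).2]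

theorem integral_integrand_zero_four_mem :
    (∫ t in (0:ℝ)..4, integrand t) ∈ Ioo (0.972106 : ℝ) 0.97210698 := by
  have h := (approxAt_of_le (le_refl 8)).integral_close
  have hq1 := (Rat.cast_le (K := ℝ)).2 nodeValue_integralPoly_mem.1
  have hq2 := (Rat.cast_le (K := ℝ)).2 nodeValue_integralPoly_mem.2
  norm_num at h hq1 hq2
  constructor <;> linarith [(abs_le.1 h).1, (abs_le.1 h).2]

theorem integrand_le_of_four_le {x : ℝ} (hx : 4 ≤ x) :
    integrand x ≤ integrand 4 * exp (79 / 10 * 4) * exp (-(79 / 10) * x) := by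
  have h4 := erf_four_ge
  have hmono : erf 4 ≤ erf x := by
    rw [erf_eq, erf_eq]
    exact mul_le_mul_of_nonneg_left (monotone_gaussPrimitive hx) (by positivity)
  rw [integrand, integrand, ← exp_add, ← exp_add, exp_le_exp]
  nlinarith [mul_nonneg (sub_nonneg.2 hmono) (sq_nonneg x), mul_nonneg (sub_nonneg.2 hx)
    (sub_nonneg.2 h4), mul_nonneg (sq_nonneg (x - 4)) (by linarith : 0 ≤ erf 4)]

theorem integrableOn_integrand_Ioi_four : IntegrableOn integrand (Ioi 4) := by
  refine ((integrableOn_exp_mul_Ioi (by norm_num : -(79 / 10 : ℝ) < 0) 4).const_mul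
    (integrand 4 * exp (79 / 10 * 4))).mono' continuous_integrand.aestronglyMeasurable ?_
  filter_upwards [ae_restrict_mem measurableSet_Ioi] with x hx
  rw [Real.norm_of_nonneg (show 0 ≤ integrand x from (exp_pos _).le)]
  exact integrand_le_of_four_le (le_of_lt hx)

theorem integral_integrand_Ioi_four_le : ∫ x in Ioi 4, integrand x ≤ 15 / 10 ^ 9 := by
  have h : ∫ x in Ioi 4, integrand x ≤
      ∫ x in Ioi 4, integrand 4 * exp (79 / 10 * 4) * exp (-(79 / 10) * x) :=
    setIntegral_mono_on integrableOn_integrand_Ioi_four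
      ((integrableOn_exp_mul_Ioi (by norm_num) 4).const_mul _) measurableSet_Ioi
      fun x hx => integrand_le_of_four_le (le_of_lt hx)
  rw [integral_const_mul, integral_exp_mul_Ioi (by norm_num)] at h
  have he : integrand 4 * exp (79 / 10 * 4) * (-exp (-(79 / 10) * 4) / -(79 / 10)) =
      integrand 4 / (79 / 10) := by
    rw [neg_mul, exp_neg]
    field_simp
  rw [he] at h
  linarith [integrand_four_le]

theorem integral_exp_neg_sq_mul_erf_bounds :
    0.972106 < (∫ x in Set.Ioi (0:ℝ), Real.exp (-x ^ 2 * erf x)) ∧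
      (∫ x in Set.Ioi (0:ℝ), Real.exp (-x ^ 2 * erf x)) < 0.972107 := by
  change 0.972106 < (∫ x in Ioi (0:ℝ), integrand x) ∧ (∫ x in Ioi (0:ℝ), integrand x) < 0.972107
  have hsplit := intervalIntegral.integral_interval_add_Ioi' (f := integrand) (μ := volume)
    (continuous_integrand.intervalIntegrable 0 4) integrableOn_integrand_Ioi_four
  have hpos : 0 ≤ ∫ x in Ioi 4, integrand x :=
    setIntegral_nonneg measurableSet_Ioi fun x _ => (exp_pos _).le
  obtain ⟨h1, h2⟩ := integral_integrand_zero_four_mem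
  rw [← hsplit]
  constructor <;> linarith [integral_integrand_Ioi_four_le]
end

section
/- The Taylor series of T(x) = ∫₀ˣ exp(−t²·erf(t)) dt at 0 converges to T everywhere: for every real t, the series ∑_{p=0}^{∞} (T^{(p)}(0)/p!)·t^p converges and its sum equals T(t). In particular the series converges to T(1) at t = 1. -/
open Real MeasureTheory

/-- `T x = ∫₀ˣ exp(−t² · erf t) dt`. -/
noncomputable def T (x : ℝ) : ℝ := ∫ t in (0:ℝ)..x, Real.exp (-t ^ 2 * erf t)

/-- `f` is the restriction to the real line of an entire function. -/
def HasEntireExtension (f : ℝ → ℝ) : Prop :=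
  ∃ F : ℂ → ℂ, Differentiable ℂ F ∧ ∀ x : ℝ, F x = f x

namespace HasEntireExtension

variable {f g : ℝ → ℝ}

theorem mul (hf : HasEntireExtension f) (hg : HasEntireExtension g) :
    HasEntireExtension fun x => f x * g x := by
  obtain ⟨F, hF, hFf⟩ := hf
  obtain ⟨G, hG, hGg⟩ := hg
  exact ⟨fun z => F z * G z, hF.mul hG, fun x => by simp [hFf, hGg]⟩

theorem exp (hf : HasEntireExtension f) : HasEntireExtension fun x => Real.exp (f x) := by
  obtain ⟨F, hF, hFf⟩ := hf
  exact ⟨fun z => Complex.exp (F z), hF.cexp, fun x => by simp [hFf]⟩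

theorem const (c : ℝ) : HasEntireExtension fun _ => c :=
  ⟨fun _ => c, differentiable_const _, fun _ => rfl⟩

theorem neg_sq : HasEntireExtension fun x => -x ^ 2 :=
  ⟨fun z => -z ^ 2, by fun_prop, fun x => by push_cast; rfl⟩

theorem integral (hf : HasEntireExtension f) :
    HasEntireExtension fun x => ∫ t in (0:ℝ)..x, f t := by
  obtain ⟨F, hF, hFf⟩ := hf
  obtain ⟨G, hG0, hG⟩ := hF.isExactOn_univ.with_val_at 0 0
  have hG' (z : ℂ) : HasDerivAt G (F z) z := hG z (Set.mem_univ z)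
  refine ⟨G, fun z => (hG' z).differentiableAt, fun x => ?_⟩
  have hcont : Continuous fun t : ℝ => F t := hF.continuous.comp Complex.continuous_ofReal
  have key := intervalIntegral.integral_eq_sub_of_hasDerivAt
    (fun t (_ : t ∈ Set.uIcc 0 x) => (hG' t).comp_ofReal) (hcont.intervalIntegrable 0 x)
  simp only [hFf, Complex.ofReal_zero, hG0, sub_zero] at key
  rw [← key, intervalIntegral.integral_ofReal]

/-- The Taylor series at `0` of the restriction of an entire function converges everywhere. -/
theorem hasSum_taylorSeries (hf : HasEntireExtension f) (t : ℝ) :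
    HasSum (fun p : ℕ => iteratedDeriv p f 0 / (p.factorial : ℝ) * t ^ p) (f t) := by
  obtain ⟨F, hF, hFf⟩ := hf
  have hderiv (n : ℕ) : iteratedDeriv n f = fun x : ℝ => (iteratedDeriv n F x).re := by
    induction n with
    | zero => ext x; simp [hFf]
    | succ n ih =>
      ext x
      rw [iteratedDeriv_succ, iteratedDeriv_succ, ih]
      have hdiff : Differentiable ℂ (iteratedDeriv n F) :=
        (hF.contDiff (n := ⊤)).differentiable_iteratedDeriv n (WithTop.coe_lt_top _)
      exact (hdiff x).hasDerivAt.real_of_complex.deriv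
  have hsum := Complex.hasSum_re (Complex.hasSum_taylorSeries_of_entire hF 0 t)
  rw [hFf, Complex.ofReal_re] at hsum
  convert hsum using 2 with p
  have hcast : (p.factorial : ℂ)⁻¹ • ((t : ℂ) - 0) ^ p • iteratedDeriv p F 0
      = (((p.factorial : ℝ)⁻¹ * t ^ p : ℝ) : ℂ) * iteratedDeriv p F 0 := by
    simp [mul_assoc]
  rw [hcast, Complex.re_ofReal_mul, hderiv]
  simp only [Complex.ofReal_zero]
  ring

end HasEntireExtension

theorem hasEntireExtension_erf : HasEntireExtension erf :=
  (HasEntireExtension.const _).mul HasEntireExtension.neg_sq.exp.integral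

theorem hasEntireExtension_T : HasEntireExtension T :=
  (HasEntireExtension.neg_sq.mul hasEntireExtension_erf).exp.integral

/-- The Taylor series of `T` at `0` converges to `T` everywhere; in particular it
converges to `T 1` at `t = 1`. -/
theorem T_taylor_series_converges :
    (∀ t : ℝ, HasSum (fun p : ℕ => iteratedDeriv p T 0 / (p.factorial : ℝ) * t ^ p) (T t)) ∧
      HasSum (fun p : ℕ => iteratedDeriv p T 0 / (p.factorial : ℝ) * (1:ℝ) ^ p) (T 1) :=
  ⟨hasEntireExtension_T.hasSum_taylorSeries, hasEntireExtension_T.hasSum_taylorSeries 1⟩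
end

section
/- For every natural number n and every real a, the (n+1)-st derivative of the error function at a is given in terms of Hermite polynomials: erf^{(n+1)}(a) = (2/√π) · (−1)ⁿ · (√2)ⁿ · Heₙ(√2·a) · exp(−a²), where Heₙ is the n-th probabilists' Hermite polynomial. In particular, all Taylor coefficients of erf at any point a are explicit Hermite-polynomial multiples of exp(−a²). -/
open Real MeasureTheory Polynomial

theorem deriv_erf : deriv erf = fun x => (2 / Real.sqrt π) * Real.exp (-x ^ 2) := by
  funext x
  have hcont : Continuous fun t : ℝ => Real.exp (-t ^ 2) := by fun_prop
  exact ((hcont.integral_hasStrictDerivAt 0 x).hasDerivAt.const_mul (2 / Real.sqrt π)).deriv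

theorem iteratedDeriv_exp_neg_sq (n : ℕ) (a : ℝ) :
    iteratedDeriv n (fun x : ℝ => Real.exp (-x ^ 2)) a =
      (-1) ^ n * Real.sqrt 2 ^ n * aeval (Real.sqrt 2 * a) (hermite n) * Real.exp (-a ^ 2) := by
  have hgauss : ContDiff ℝ n fun y : ℝ => Real.exp (-(y ^ 2 / 2)) := by fun_prop
  have hsq (x : ℝ) : x ^ 2 = (Real.sqrt 2 * x) ^ 2 / 2 := by
    rw [mul_pow, Real.sq_sqrt zero_le_two]
    ring
  have hexp : (fun x : ℝ => Real.exp (-x ^ 2)) =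
      fun x => Real.exp (-((Real.sqrt 2 * x) ^ 2 / 2)) := by
    funext x
    rw [← hsq]
  rw [hexp, iteratedDeriv_comp_const_mul hgauss]
  beta_reduce
  rw [iteratedDeriv_eq_iterate, deriv_gaussian_eq_hermite_mul_gaussian, ← hsq]
  ring

/-- `erf^{(n+1)}(a) = (2/√π) (−1)ⁿ (√2)ⁿ Heₙ(√2 a) exp(−a²)`, where `Heₙ` is the
`n`-th probabilists' Hermite polynomial. -/
theorem iteratedDeriv_erf (n : ℕ) (a : ℝ) :
    iteratedDeriv (n + 1) erf a =
      (2 / Real.sqrt π) * (-1) ^ n * Real.sqrt 2 ^ n *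
        (Polynomial.aeval (Real.sqrt 2 * a) (Polynomial.hermite n)) * Real.exp (-a ^ 2) := by
  rw [iteratedDeriv_succ', deriv_erf, iteratedDeriv_const_mul_field, iteratedDeriv_exp_neg_sq]
  ring
end

section
/- Define F(a) = ∫₀^∞ (erf(x)² − (1 − exp(−a·x²)))² dx for a > 0. Then F((1+π)^{2/3}·(ln 2)²) < F(π²/8); that is, the parameter a = (1+π)^{2/3}·(ln 2)² gives a strictly smaller least-squares error for the approximation erf(x)² ≈ 1 − exp(−a·x²) than a = π²/8 does. -/
open Real MeasureTheory

/-- The least-squares error of the approximation `erf(x)² ≈ 1 − exp(−a x²)`. -/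
noncomputable def lsqError (a : ℝ) : ℝ :=
  ∫ x in Set.Ioi (0:ℝ), (erf x ^ 2 - (1 - Real.exp (-a * x ^ 2))) ^ 2

open Filter Topology Set

lemma hasDerivAt_erf (x : ℝ) : HasDerivAt erf (2 / √π * Real.exp (-x ^ 2)) x := by
  have h : Continuous fun t : ℝ => Real.exp (-t ^ 2) := by fun_prop
  exact (h.integral_hasStrictDerivAt 0 x).hasDerivAt.const_mul _

@[fun_prop]
lemma continuous_erf : Continuous erf :=
  continuous_iff_continuousAt.2 fun x => (hasDerivAt_erf x).continuousAt

@[simp]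
lemma erf_zero : erf 0 = 0 := by simp [erf]

lemma erf_nonneg {x : ℝ} (hx : 0 ≤ x) : 0 ≤ erf x :=
  mul_nonneg (by positivity)
    (intervalIntegral.integral_nonneg hx fun t _ => (Real.exp_pos _).le)

lemma one_sub_erf {x : ℝ} (hx : 0 ≤ x) :
    1 - erf x = 2 / √π * ∫ t in Ioi x, Real.exp (-t ^ 2) := by
  have hi : Integrable fun t : ℝ => Real.exp (-t ^ 2) := by
    simpa using integrable_exp_neg_mul_sq one_pos
  have h := intervalIntegral.integral_Ioi_sub_Ioi hi.integrableOn hx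
  have hg : ∫ t in Ioi (0 : ℝ), Real.exp (-t ^ 2) = √π / 2 := by
    simpa using integral_gaussian_Ioi 1
  have hp : √π ≠ 0 := by positivity
  rw [erf, ← h, hg]
  field_simp
  ring

lemma erf_le_one {x : ℝ} (hx : 0 ≤ x) : erf x ≤ 1 := by
  have h : 0 ≤ 2 / √π * ∫ t in Ioi x, Real.exp (-t ^ 2) :=
    mul_nonneg (by positivity) (integral_nonneg fun t => (Real.exp_pos _).le)
  linarith [one_sub_erf hx]

lemma one_sub_erf_le {x : ℝ} (hx : 0 ≤ x) :
    1 - erf x ≤ 2 / √π * Real.exp (1 / 4) * Real.exp (-x) := by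
  have hi : Integrable fun t : ℝ => Real.exp (-t ^ 2) := by
    simpa using integrable_exp_neg_mul_sq one_pos
  have hj : IntegrableOn (fun t : ℝ => Real.exp (1 / 4) * Real.exp (-t)) (Ioi x) := by
    have h : IntegrableOn (fun t : ℝ => Real.exp (-t)) (Ioi x) := by
      simpa using exp_neg_integrableOn_Ioi x one_pos
    exact h.const_mul _
  rw [one_sub_erf hx, mul_assoc, ← integral_exp_neg_Ioi, ← integral_const_mul (Real.exp (1 / 4))]
  refine mul_le_mul_of_nonneg_left ?_ (by positivity)
  refine setIntegral_mono hi.integrableOn hj fun t => ?_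
  dsimp only
  rw [← Real.exp_add, Real.exp_le_exp]
  nlinarith [sq_nonneg (t - 1 / 2)]

lemma integrableOn_one_sub_erf_sq_sq :
    IntegrableOn (fun x => (1 - erf x ^ 2) ^ 2) (Ioi 0) := by
  have hj : IntegrableOn (fun t : ℝ => 2 * (2 / √π * Real.exp (1 / 4)) * Real.exp (-t))
      (Ioi 0) := by
    have h : IntegrableOn (fun t : ℝ => Real.exp (-t)) (Ioi 0) := by
      simpa using exp_neg_integrableOn_Ioi 0 one_pos
    exact h.const_mul _
  refine hj.mono' (by fun_prop) ?_
  filter_upwards [ae_restrict_mem measurableSet_Ioi] with x hx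
  have hx : 0 ≤ x := le_of_lt hx
  have h0 := erf_nonneg hx
  have h1 := erf_le_one hx
  have h2 := one_sub_erf_le hx
  rw [Real.norm_of_nonneg (sq_nonneg _)]
  have h3 : erf x ^ 2 ≤ 1 := by nlinarith
  nlinarith [sq_nonneg (erf x), sq_nonneg (1 - erf x)]

lemma integrableOn_erf_mul {f : ℝ → ℝ} {b : ℝ} (hb : 0 ≤ b) (hf : IntegrableOn f (Ioi 0)) :
    IntegrableOn (fun x => erf (b * x) * f x) (Ioi 0) := by
  refine hf.bdd_mul (c := 1) (by fun_prop) ?_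
  filter_upwards [ae_restrict_mem measurableSet_Ioi] with x hx
  have hx : 0 ≤ b * x := mul_nonneg hb (le_of_lt hx)
  rw [Real.norm_of_nonneg (erf_nonneg hx)]
  exact erf_le_one hx

lemma integral_erf_mul_mul_exp {b c : ℝ} (hb : 0 ≤ b) (hc : 0 < c) :
    ∫ x in Ioi (0 : ℝ), erf (b * x) * (x * Real.exp (-c * x ^ 2)) =
      b / (2 * c * √(b ^ 2 + c)) := by
  have hbc : 0 < b ^ 2 + c := by positivity
  have h1 : IntegrableOn (fun x => erf (b * x) * (x * Real.exp (-c * x ^ 2))) (Ioi 0) :=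
    integrableOn_erf_mul hb (integrable_mul_exp_neg_mul_sq hc).integrableOn
  have h2 : IntegrableOn (fun x => b / (√π * c) * Real.exp (-(b ^ 2 + c) * x ^ 2)) (Ioi 0) :=
    ((integrable_exp_neg_mul_sq hbc).const_mul _).integrableOn
  have hd : ∀ x : ℝ, HasDerivAt (fun x => -(erf (b * x) * Real.exp (-c * x ^ 2)) / (2 * c))
      (erf (b * x) * (x * Real.exp (-c * x ^ 2)) -
        b / (√π * c) * Real.exp (-(b ^ 2 + c) * x ^ 2)) x := by
    intro x
    have e1 : HasDerivAt (fun x => erf (b * x)) (2 / √π * Real.exp (-(b * x) ^ 2) * (b * 1)) x :=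
      (hasDerivAt_erf (b * x)).comp x ((hasDerivAt_id x).const_mul b)
    have e2 : HasDerivAt (fun x => Real.exp (-c * x ^ 2))
        (Real.exp (-c * x ^ 2) * (-c * (2 * x))) x := by
      simpa using (((hasDerivAt_id x).pow 2).const_mul (-c)).exp
    refine ((e1.mul e2).neg.div_const (2 * c)).congr_deriv ?_
    have e3 : Real.exp (-(b ^ 2 + c) * x ^ 2) =
        Real.exp (-(b * x) ^ 2) * Real.exp (-c * x ^ 2) := by
      rw [← Real.exp_add]; ring_nf
    have hp : √π ≠ 0 := by positivity
    rw [e3]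
    field_simp
    ring
  have hlim : Tendsto (fun x => -(erf (b * x) * Real.exp (-c * x ^ 2)) / (2 * c)) atTop (𝓝 0) := by
    have e : Tendsto (fun x : ℝ => Real.exp (-c * x ^ 2)) atTop (𝓝 0) :=
      Real.tendsto_exp_atBot.comp
        ((tendsto_pow_atTop two_ne_zero).const_mul_atTop_of_neg (neg_lt_zero.2 hc))
    have e' : Tendsto (fun x => erf (b * x) * Real.exp (-c * x ^ 2)) atTop (𝓝 0) := by
      refine squeeze_zero' ?_ ?_ e <;> filter_upwards [eventually_ge_atTop 0] with x hx
      · exact mul_nonneg (erf_nonneg (by positivity)) (Real.exp_pos _).le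
      · exact mul_le_of_le_one_left (Real.exp_pos _).le (erf_le_one (by positivity))
    simpa using e'.neg.div_const (2 * c)
  have h := integral_Ioi_of_hasDerivAt_of_tendsto (hd 0).continuousAt.continuousWithinAt
    (fun x _ => hd x) (h1.sub h2) hlim
  rw [integral_sub h1 h2, integral_const_mul, integral_gaussian_Ioi] at h
  simp only [mul_zero, erf_zero, zero_mul, neg_zero, zero_div, sub_zero, sub_eq_zero] at h
  rw [h, Real.sqrt_div Real.pi_pos.le]
  have hp : √π ≠ 0 := by positivity
  field_simp

lemma erf_sq_eq_integral (x : ℝ) :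
    erf x ^ 2 = ∫ b in (0 : ℝ)..1, 4 / √π * (erf (b * x) * (x * Real.exp (-(b * x) ^ 2))) := by
  rw [intervalIntegral.integral_eq_sub_of_hasDerivAt (f := fun b => erf (b * x) ^ 2)]
  · simp
  · intro b _
    have e1 : HasDerivAt (fun b => erf (b * x)) (2 / √π * Real.exp (-(b * x) ^ 2) * (1 * x)) b :=
      HasDerivAt.comp (h₂ := erf) b (hasDerivAt_erf (b * x)) ((hasDerivAt_id b).mul_const x)
    refine (e1.pow 2).congr_deriv ?_
    push_cast
    ring
  · exact Continuous.intervalIntegrable (by fun_prop) _ _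

lemma integral_erf_sq_mul_exp {a : ℝ} (ha : 0 < a) :
    ∫ x in Ioi (0 : ℝ), erf x ^ 2 * Real.exp (-a * x ^ 2) =
      2 / (√π * √a) * (Real.arctan √(1 + 2 / a) - π / 4) := by
  have hF : Integrable (Function.uncurry fun x b : ℝ =>
      4 / √π * (erf (b * x) * (x * Real.exp (-(a + b ^ 2) * x ^ 2))))
      ((volume.restrict (Ioi 0)).prod (volume.restrict (Ioc 0 1))) := by
    have h1 : IntegrableOn (fun x => 4 / √π * (x * Real.exp (-a * x ^ 2))) (Ioi 0) :=
      ((integrable_mul_exp_neg_mul_sq ha).const_mul _).integrableOn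
    have h2 : IntegrableOn (fun _ : ℝ => (1 : ℝ)) (Ioc 0 1) := by simp
    refine (h1.mul_prod h2).mono' (by unfold Function.uncurry; fun_prop) ?_
    rw [Measure.prod_restrict]
    filter_upwards [ae_restrict_mem (measurableSet_Ioi.prod measurableSet_Ioc)] with z hz
    obtain ⟨x, b⟩ := z
    obtain ⟨hx : 0 < x, hb : 0 < b, -⟩ := hz
    have h0 := erf_nonneg (x := b * x) (by positivity)
    have h1 := erf_le_one (x := b * x) (by positivity)
    simp only [Function.uncurry, mul_one]
    rw [Real.norm_of_nonneg (by positivity)]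
    have h2 : Real.exp (-(a + b ^ 2) * x ^ 2) ≤ Real.exp (-a * x ^ 2) :=
      Real.exp_le_exp.2 (by nlinarith [mul_nonneg (sq_nonneg b) (sq_nonneg x)])
    refine mul_le_mul_of_nonneg_left ?_ (by positivity)
    refine (mul_le_of_le_one_left (by positivity) h1).trans ?_
    exact mul_le_mul_of_nonneg_left h2 hx.le
  have hinner : ∀ x : ℝ, erf x ^ 2 * Real.exp (-a * x ^ 2) = ∫ b in Ioc (0 : ℝ) 1,
      4 / √π * (erf (b * x) * (x * Real.exp (-(a + b ^ 2) * x ^ 2))) := by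
    intro x
    rw [erf_sq_eq_integral, intervalIntegral.integral_of_le zero_le_one, ← integral_mul_const]
    congr 1 with b
    rw [show -(a + b ^ 2) * x ^ 2 = -(b * x) ^ 2 + -a * x ^ 2 by ring, Real.exp_add]
    ring
  have houter : ∀ b ∈ Ioc (0 : ℝ) 1, (∫ x in Ioi (0 : ℝ),
      4 / √π * (erf (b * x) * (x * Real.exp (-(a + b ^ 2) * x ^ 2)))) =
      2 / √π * (b / ((a + b ^ 2) * √(a + 2 * b ^ 2))) := by
    intro b hb
    have hp : √π ≠ 0 := by positivity
    have hs : √(a + 2 * b ^ 2) ≠ 0 := by positivity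
    rw [integral_const_mul, integral_erf_mul_mul_exp hb.1.le (by positivity),
      show b ^ 2 + (a + b ^ 2) = a + 2 * b ^ 2 by ring]
    field_simp
    ring
  simp_rw [hinner]
  rw [integral_integral_swap hF, setIntegral_congr_fun measurableSet_Ioc houter,
    ← intervalIntegral.integral_of_le zero_le_one, intervalIntegral.integral_eq_sub_of_hasDerivAt
      (f := fun b => 2 / (√π * √a) * Real.arctan (√(a + 2 * b ^ 2) / √a))]
  · have hs : √a ≠ 0 := by positivity
    rw [← Real.sqrt_div' _ ha.le]
    simp [hs, add_div, ha.ne']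
    ring
  · intro b _
    have hpos : 0 < a + 2 * b ^ 2 := by positivity
    have e1 : HasDerivAt (fun b : ℝ => a + 2 * b ^ 2) (2 * (2 * b)) b := by
      simpa using (((hasDerivAt_id b).pow 2).const_mul 2).const_add a
    refine (((e1.sqrt hpos.ne').div_const √a).arctan.const_mul (2 / (√π * √a))).congr_deriv ?_
    have hp : √π ≠ 0 := by positivity
    have hs : √a ≠ 0 := by positivity
    have hs' : √(a + 2 * b ^ 2) ≠ 0 := by positivity
    rw [div_pow, Real.sq_sqrt hpos.le, Real.sq_sqrt ha.le]
    field_simp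
    rw [Real.sq_sqrt ha.le]
    field_simp
    ring
  · refine Continuous.intervalIntegrable ?_ _ _
    refine continuous_const.mul (continuous_id.div (by fun_prop) fun b => ?_)
    positivity

lemma lsqError_eq {a : ℝ} (ha : 0 < a) :
    lsqError a = (∫ x in Ioi (0 : ℝ), (1 - erf x ^ 2) ^ 2) + 4 / √(2 * π) *
      (√(2 / a) * (Real.arctan √(1 + √(2 / a) ^ 2) - (π / 2 - π * √2 / 16))) := by
  have h1 : IntegrableOn (fun x => Real.exp (-a * x ^ 2)) (Ioi 0) :=
    (integrable_exp_neg_mul_sq ha).integrableOn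
  have h2 : IntegrableOn (fun x => Real.exp (-(2 * a) * x ^ 2)) (Ioi 0) :=
    (integrable_exp_neg_mul_sq (by positivity)).integrableOn
  have h3 : IntegrableOn (fun x => erf x ^ 2 * Real.exp (-a * x ^ 2)) (Ioi 0) := by
    convert integrableOn_erf_mul zero_le_one (integrableOn_erf_mul zero_le_one h1) using 2
    simp only [one_mul]
    ring
  have h4 : IntegrableOn (fun x => 2 * (erf x ^ 2 * Real.exp (-a * x ^ 2) -
      Real.exp (-a * x ^ 2))) (Ioi 0) := (h3.sub h1).const_mul 2
  have h5 : IntegrableOn (fun x => (1 - erf x ^ 2) ^ 2 + 2 * (erf x ^ 2 * Real.exp (-a * x ^ 2) -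
      Real.exp (-a * x ^ 2))) (Ioi 0) := integrableOn_one_sub_erf_sq_sq.add h4
  have e : lsqError a = ∫ x in Ioi (0 : ℝ), ((1 - erf x ^ 2) ^ 2 +
      2 * (erf x ^ 2 * Real.exp (-a * x ^ 2) - Real.exp (-a * x ^ 2)) +
      Real.exp (-(2 * a) * x ^ 2)) := by
    unfold lsqError
    congr 1 with x
    rw [show -(2 * a) * x ^ 2 = -a * x ^ 2 + -a * x ^ 2 by ring, Real.exp_add]
    ring
  rw [e, integral_add h5 h2,
    integral_add integrableOn_one_sub_erf_sq_sq h4, integral_const_mul,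
    integral_sub h3 h1, integral_erf_sq_mul_exp ha, integral_gaussian_Ioi, integral_gaussian_Ioi,
    Real.sq_sqrt (by positivity), Real.sqrt_div Real.pi_pos.le, Real.sqrt_div Real.pi_pos.le,
    Real.sqrt_div zero_le_two, Real.sqrt_mul zero_le_two, Real.sqrt_mul zero_le_two]
  have hp : √π ≠ 0 := by positivity
  have hs : √a ≠ 0 := by positivity
  have h2 : √(2 : ℝ) ≠ 0 := by positivity
  have hp2 : √π ^ 2 = π := Real.sq_sqrt Real.pi_pos.le
  have h22 : √(2 : ℝ) ^ 2 = 2 := Real.sq_sqrt zero_le_two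
  field_simp
  simp only [hp2]
  ring_nf
  simp only [h22]
  ring_nf

/-- A lower bound for `arctan` by its Taylor polynomial of degree seven. -/
lemma arctan_ge_taylor {x : ℝ} (hx : 0 ≤ x) :
    x - x ^ 3 / 3 + x ^ 5 / 5 - x ^ 7 / 7 ≤ Real.arctan x := by
  have hd : ∀ y : ℝ, HasDerivAt
      (fun y => Real.arctan y - (y - y ^ 3 / 3 + y ^ 5 / 5 - y ^ 7 / 7))
      (1 / (1 + y ^ 2) - (1 - 3 * y ^ 2 / 3 + 5 * y ^ 4 / 5 - 7 * y ^ 6 / 7)) y := by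
    intro y
    have h3 := (hasDerivAt_pow 3 y).div_const 3
    have h5 := (hasDerivAt_pow 5 y).div_const 5
    have h7 := (hasDerivAt_pow 7 y).div_const 7
    refine ((Real.hasDerivAt_arctan y).sub
      ((((hasDerivAt_id y).sub h3).add h5).sub h7)).congr_deriv ?_
    norm_num
  have hm : Monotone (fun y : ℝ => Real.arctan y - (y - y ^ 3 / 3 + y ^ 5 / 5 - y ^ 7 / 7)) := by
    refine monotone_of_hasDerivAt_nonneg hd fun y => ?_
    have : 1 / (1 + y ^ 2) - (1 - 3 * y ^ 2 / 3 + 5 * y ^ 4 / 5 - 7 * y ^ 6 / 7) =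
        y ^ 8 / (1 + y ^ 2) := by
      field_simp
      ring
    simp only [Pi.zero_apply]
    rw [this]
    positivity
  simpa using hm hx

lemma monotoneOn_arctan_add :
    MonotoneOn (fun w : ℝ => Real.arctan w + (2 * w / (1 + w ^ 2) - 1 / w)) (Ioi 0) := by
  have hd : ∀ w ∈ Ioi (0 : ℝ), HasDerivAt
      (fun w : ℝ => Real.arctan w + (2 * w / (1 + w ^ 2) - 1 / w))
      ((1 + 5 * w ^ 2) / (w ^ 2 * (1 + w ^ 2) ^ 2)) w := by
    intro w hw
    have hw : w ≠ 0 := ne_of_gt hw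
    have h1 : HasDerivAt (fun w : ℝ => 2 * w) (2 * 1) w := (hasDerivAt_id w).const_mul 2
    have h2 : HasDerivAt (fun w : ℝ => 1 + w ^ 2) (2 * w) w := by
      simpa using (hasDerivAt_pow 2 w).const_add 1
    have h3 : HasDerivAt (fun w : ℝ => 1 / w) (-(w ^ 2)⁻¹) w := by
      simpa using hasDerivAt_inv hw
    refine ((Real.hasDerivAt_arctan w).add ((h1.div h2 (by positivity)).sub h3)).congr_deriv ?_
    field_simp
    ring
  refine monotoneOn_of_deriv_nonneg (convex_Ioi 0)
    (fun w hw => (hd w hw).continuousAt.continuousWithinAt)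
    (fun w hw => (hd w (interior_subset hw)).differentiableAt.differentiableWithinAt) ?_
  intro w hw
  rw [(hd w (interior_subset hw)).deriv]
  positivity

lemma hasDerivAt_mul_arctan_sqrt (c r : ℝ) :
    HasDerivAt (fun r => r * (Real.arctan √(1 + r ^ 2) - c))
      (Real.arctan √(1 + r ^ 2) + (2 * √(1 + r ^ 2) / (1 + √(1 + r ^ 2) ^ 2) -
        1 / √(1 + r ^ 2)) - c) r := by
  have h1 : HasDerivAt (fun r : ℝ => 1 + r ^ 2) (2 * r) r := by
    simpa using (hasDerivAt_pow 2 r).const_add 1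
  have hpos : 0 < 1 + r ^ 2 := by positivity
  refine ((hasDerivAt_id r).mul ((h1.sqrt hpos.ne').arctan.sub_const c)).congr_deriv ?_
  have hs : √(1 + r ^ 2) ≠ 0 := by positivity
  have hr : r ^ 2 = √(1 + r ^ 2) ^ 2 - 1 := by rw [Real.sq_sqrt hpos.le]; ring
  have hp2 : 0 < 1 + √(1 + r ^ 2) ^ 2 := by positivity
  simp only [id]
  generalize √(1 + r ^ 2) = w at *
  field_simp
  rw [hr]
  ring

/-- The slope of `r ↦ r (arctan √(1 + r²) - c)` to the right of `u` is bounded below by a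
rational expression in `x`, where `(1 + x) / (1 - x) ≤ √(1 + u²)`. -/
lemma slope_mul_arctan_sqrt {c x u r s : ℝ} (hx : 0 ≤ x) (hx1 : x < 1) (hu : 0 ≤ u)
    (hxu : ((1 + x) / (1 - x)) ^ 2 ≤ 1 + u ^ 2) (hur : u ≤ r) (hrs : r ≤ s) :
    (π / 4 + (x - x ^ 3 / 3 + x ^ 5 / 5 - x ^ 7 / 7) + ((1 - x ^ 2) / (1 + x ^ 2) -
      (1 - x) / (1 + x)) - c) * (s - r) ≤
      s * (Real.arctan √(1 + s ^ 2) - c) - r * (Real.arctan √(1 + r ^ 2) - c) := by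
  have hx2 : 0 < 1 - x := by linarith
  refine Convex.mul_sub_le_image_sub_of_le_deriv (convex_Ici u)
    (f := fun r => r * (Real.arctan √(1 + r ^ 2) - c))
    (fun r _ => (hasDerivAt_mul_arctan_sqrt c r).continuousAt.continuousWithinAt)
    (fun r _ => (hasDerivAt_mul_arctan_sqrt c r).differentiableAt.differentiableWithinAt)
    (fun t ht => ?_) r hur s (hur.trans hrs) hrs
  have ht : u ≤ t := interior_subset ht
  rw [(hasDerivAt_mul_arctan_sqrt c t).deriv]
  have hw : 0 < (1 + x) / (1 - x) := by positivity
  have hwt : (1 + x) / (1 - x) ≤ √(1 + t ^ 2) := Real.le_sqrt_of_sq_le (by nlinarith)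
  have h := monotoneOn_arctan_add hw (hw.trans_le hwt) hwt
  have ha : π / 4 + Real.arctan x = Real.arctan ((1 + x) / (1 - x)) := by
    rw [← Real.arctan_one, Real.arctan_add (by linarith), one_mul]
  have hq : 2 * ((1 + x) / (1 - x)) / (1 + ((1 + x) / (1 - x)) ^ 2) - 1 / ((1 + x) / (1 - x)) =
      (1 - x ^ 2) / (1 + x ^ 2) - (1 - x) / (1 + x) := by
    have : (1 - x) ^ 2 + (1 + x) ^ 2 ≠ 0 := by positivity
    field_simp
    ring
  simp only [hq, ← ha] at h
  linarith [arctan_ge_taylor hx]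

/-- The parameter `a = (1+π)^{2/3} (ln 2)²` gives a strictly smaller least-squares
error than `a = π²/8`. -/
theorem lsqError_lt :
    lsqError ((1 + π) ^ ((2:ℝ)/3) * Real.log 2 ^ 2) < lsqError (π ^ 2 / 8) := by
  have hπ1 := Real.pi_gt_d6
  have hπ2 := Real.pi_lt_d6
  have hl1 := Real.log_two_gt_d9
  have hl2 := Real.log_two_lt_d9
  set y : ℝ := (1 + π) ^ ((2 : ℝ) / 3) with hy
  have hy0 : 0 < y := by positivity
  have hy3 : y ^ 3 = (1 + π) ^ 2 := by
    rw [hy, ← Real.rpow_natCast, ← Real.rpow_mul (by positivity), ← Real.rpow_natCast]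
    norm_num
  have hy1 : 2.578 < y := by
    refine lt_of_pow_lt_pow_left₀ 3 hy0.le ?_
    rw [hy3]
    nlinarith
  have hy2 : y < 2.58 := by
    refine lt_of_pow_lt_pow_left₀ 3 (by norm_num) ?_
    rw [hy3]
    nlinarith
  have hL1 : 0.48045 < Real.log 2 ^ 2 := by nlinarith
  have hL2 : Real.log 2 ^ 2 < 0.48046 := by nlinarith
  have ha1 : 1.2386 < y * Real.log 2 ^ 2 := by nlinarith
  have ha2 : y * Real.log 2 ^ 2 < 1.24 := by nlinarith
  have ha : 0 < y * Real.log 2 ^ 2 := by positivity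
  have hr1 : 1.27 ≤ √(2 / (y * Real.log 2 ^ 2)) := by
    refine Real.le_sqrt_of_sq_le ?_
    rw [le_div_iff₀ ha]
    nlinarith
  have hr2 : √(2 / (y * Real.log 2 ^ 2)) ≤ 1.2718 := by
    refine Real.sqrt_le_iff.2 ⟨by norm_num, ?_⟩
    rw [div_le_iff₀ ha]
    nlinarith
  have hb : √(2 / (π ^ 2 / 8)) = 4 / π := by
    rw [show 2 / (π ^ 2 / 8) = (4 / π) ^ 2 by field_simp; norm_num]
    exact Real.sqrt_sq (by positivity)
  have hb1 : 1.27323 < 4 / π := by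
    rw [lt_div_iff₀ Real.pi_pos]
    nlinarith
  rw [lsqError_eq ha, lsqError_eq (by positivity), hb]
  generalize √(2 / (y * Real.log 2 ^ 2)) = r at *
  refine (add_lt_add_iff_left _).2 (mul_lt_mul_of_pos_left ?_ (by positivity))
  have hs1 : 1.41421356 < √2 := Real.lt_sqrt_of_sq_lt (by norm_num)
  have hc : π / 2 - π * √2 / 16 < π / 4 + 0.5077185 := by nlinarith
  have h1 := slope_mul_arctan_sqrt (c := π / 2 - π * √2 / 16) (x := 0.2356) (u := 1.27)
    (by norm_num) (by norm_num) (by norm_num) (by norm_num) hr1 hr2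
  have h2 := slope_mul_arctan_sqrt (c := π / 2 - π * √2 / 16) (x := 0.236) (u := 1.2718)
    (by norm_num) (by norm_num) (by norm_num) (by norm_num) le_rfl
    (show 1.2718 ≤ 4 / π by linarith)
  have h3 : -0.00017 * (1.2718 - r) ≤ _ := (mul_le_mul_of_nonneg_right (by norm_num; linarith)
    (by linarith)).trans h1
  have h4 : 0.00039 * (4 / π - 1.2718) ≤ _ := (mul_le_mul_of_nonneg_right (by norm_num; linarith)
    (by linarith)).trans h2
  linarith
end
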